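/- If E and F are both Cheeger sets in a nonempty bounded open set Ω ⊆ ℝⁿ (n ≥ 2), then E ∪ F is a Cheeger set in Ω, and E ∩ F is also a Cheeger set in Ω provided |E ∩ F| > 0. -/

import Mathlib

open MeasureTheory Metric Set Filter
open scoped ENNReal NNReal Topology Pointwise

noncomputable section

/-- The divergence of a vector field on `ℝⁿ`. -/
def divergence {n : ℕ} (g : EuclideanSpace ℝ (Fin n) → EuclideanSpace ℝ (Fin n))
    (x : EuclideanSpace ℝ (Fin n)) : ℝ :=
  LinearMap.trace ℝ (EuclideanSpace ℝ (Fin n)) (fderiv ℝ g x).toLinearMap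

/-- The (distributional) perimeter of a set `F ⊆ ℝⁿ`:
`P(F) = sup {∫_F div g : g ∈ C¹_c(ℝⁿ;ℝⁿ), ‖g‖ ≤ 1}`. -/
def perimeter {n : ℕ} (F : Set (EuclideanSpace ℝ (Fin n))) : ℝ≥0∞ :=
  ⨆ g ∈ {g : EuclideanSpace ℝ (Fin n) → EuclideanSpace ℝ (Fin n) |
      ContDiff ℝ 1 g ∧ HasCompactSupport g ∧ ∀ x, ‖g x‖ ≤ 1},
    ENNReal.ofReal (∫ x in F, divergence g x)

/-- The Cheeger constant of `Ω`:
`h(Ω) = inf {P(F) / |F| : F ⊆ Ω Borel, |F| > 0}`. -/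
def cheegerConstant {n : ℕ} (Ω : Set (EuclideanSpace ℝ (Fin n))) : ℝ≥0∞ :=
  ⨅ F ∈ {F : Set (EuclideanSpace ℝ (Fin n)) | MeasurableSet F ∧ F ⊆ Ω ∧ 0 < volume F},
    perimeter F / volume F

/-- `F` is a Cheeger set in `Ω`: a Borel subset of `Ω` of positive volume
whose ratio `P(F)/|F|` attains the Cheeger constant of `Ω`. -/
def IsCheegerSet {n : ℕ} (Ω F : Set (EuclideanSpace ℝ (Fin n))) : Prop :=
  MeasurableSet F ∧ F ⊆ Ω ∧ 0 < volume F ∧ perimeter F / volume F = cheegerConstant Ω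

/-- Continuously differentiable compactly supported vector fields bounded by one: the competitors
in the definition of the perimeter. -/
def IsAdmissibleField {n : ℕ} (g : EuclideanSpace ℝ (Fin n) → EuclideanSpace ℝ (Fin n)) : Prop :=
  ContDiff ℝ 1 g ∧ HasCompactSupport g ∧ ∀ x, ‖g x‖ ≤ 1

section Divergence

variable {n : ℕ} {g g₁ g₂ : EuclideanSpace ℝ (Fin n) → EuclideanSpace ℝ (Fin n)}
  {f : EuclideanSpace ℝ (Fin n) → ℝ}

lemma divergence_eq_sum_inner (g : EuclideanSpace ℝ (Fin n) → EuclideanSpace ℝ (Fin n))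
    (x : EuclideanSpace ℝ (Fin n)) :
    divergence g x = ∑ i, inner ℝ (EuclideanSpace.basisFun (Fin n) ℝ i)
      (fderiv ℝ g x (EuclideanSpace.basisFun (Fin n) ℝ i)) :=
  LinearMap.trace_eq_sum_inner _ (EuclideanSpace.basisFun (Fin n) ℝ)

lemma continuous_divergence (hg : ContDiff ℝ 1 g) : Continuous (divergence g) := by
  have h : Continuous (fderiv ℝ g) := hg.continuous_fderiv one_ne_zero
  simp_rw [funext (divergence_eq_sum_inner g)]
  fun_prop

lemma hasCompactSupport_divergence (hg : HasCompactSupport g) :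
    HasCompactSupport (divergence g) :=
  (hg.fderiv (𝕜 := ℝ)).comp_left
    (g := fun L : EuclideanSpace ℝ (Fin n) →L[ℝ] EuclideanSpace ℝ (Fin n) =>
      LinearMap.trace ℝ (EuclideanSpace ℝ (Fin n)) L.toLinearMap) (by simp)

lemma integrable_divergence (hg : ContDiff ℝ 1 g) (hg' : HasCompactSupport g) :
    Integrable (divergence g) :=
  (continuous_divergence hg).integrable_of_hasCompactSupport (hasCompactSupport_divergence hg')

lemma divergence_add (hg₁ : ContDiff ℝ 1 g₁) (hg₂ : ContDiff ℝ 1 g₂)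
    (x : EuclideanSpace ℝ (Fin n)) :
    divergence (fun y => g₁ y + g₂ y) x = divergence g₁ x + divergence g₂ x := by
  simp only [divergence]
  rw [fderiv_fun_add (hg₁.differentiable one_ne_zero x) (hg₂.differentiable one_ne_zero x)]
  simp

lemma divergence_sub (hg₁ : ContDiff ℝ 1 g₁) (hg₂ : ContDiff ℝ 1 g₂)
    (x : EuclideanSpace ℝ (Fin n)) :
    divergence (fun y => g₁ y - g₂ y) x = divergence g₁ x - divergence g₂ x := by
  simp only [divergence]
  rw [fderiv_fun_sub (hg₁.differentiable one_ne_zero x) (hg₂.differentiable one_ne_zero x)]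
  simp

lemma divergence_smul (hf : ContDiff ℝ 1 f) (hg : ContDiff ℝ 1 g)
    (x : EuclideanSpace ℝ (Fin n)) :
    divergence (fun y => f y • g y) x = f x * divergence g x + fderiv ℝ f x (g x) := by
  simp only [divergence]
  rw [fderiv_fun_smul (hf.differentiable one_ne_zero x) (hg.differentiable one_ne_zero x)]
  simp

lemma divergence_const_smul (c : ℝ) (hg : ContDiff ℝ 1 g) (x : EuclideanSpace ℝ (Fin n)) :
    divergence (fun y => c • g y) x = c * divergence g x := by
  simp only [divergence]
  rw [fderiv_fun_const_smul (hg.differentiable one_ne_zero x)]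
  simp

lemma hasCompactSupport_smul_field (f : EuclideanSpace ℝ (Fin n) → ℝ)
    (hg : HasCompactSupport g) : HasCompactSupport (fun y => f y • g y) :=
  hg.mono fun y hy => by
    contrapose! hy
    simp_all

lemma divergence_comp_add_right (t x : EuclideanSpace ℝ (Fin n)) :
    divergence (fun y => g (y + t)) x = divergence g (x + t) := by
  simp only [divergence, fderiv_comp_add_right]

lemma integral_divergence_eq_zero (hg : ContDiff ℝ 1 g) (hg' : HasCompactSupport g) :
    ∫ x, divergence g x = 0 := by
  have hc : Continuous (fderiv ℝ g) := hg.continuous_fderiv one_ne_zero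
  have hint (v : EuclideanSpace ℝ (Fin n)) : Integrable (fun x => fderiv ℝ g x v) := by
    refine Continuous.integrable_of_hasCompactSupport (by fun_prop) ?_
    exact (hg'.fderiv (𝕜 := ℝ)).comp_left
      (g := fun L : EuclideanSpace ℝ (Fin n) →L[ℝ] EuclideanSpace ℝ (Fin n) => L v) (by simp)
  have hzero (v : EuclideanSpace ℝ (Fin n)) : ∫ x, fderiv ℝ g x v = 0 := by
    simpa using integral_smul_fderiv_eq_neg_fderiv_smul_of_integrable (𝕜 := ℝ)
      (f := fun _ : EuclideanSpace ℝ (Fin n) => (1 : ℝ)) (g := g) (v := v) (μ := volume)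
      (by simp) (by simpa using hint v)
      (by simpa using hg.continuous.integrable_of_hasCompactSupport hg')
      (fun x _ => by fun_prop) (fun x _ => hg.differentiable one_ne_zero x)
  simp_rw [divergence_eq_sum_inner]
  rw [integral_finsetSum _ fun i _ => (hint _).const_inner _]
  refine Finset.sum_eq_zero fun i _ => ?_
  rw [integral_inner (hint _), hzero, inner_zero_right]

/-- Integration by parts against a compactly supported vector field. -/
lemma integral_mul_divergence (hf : ContDiff ℝ 1 f) (hg : ContDiff ℝ 1 g)
    (hg' : HasCompactSupport g) :
    ∫ x, f x * divergence g x = -∫ x, fderiv ℝ f x (g x) := by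
  have hfg : ContDiff ℝ 1 (fun y => f y • g y) := hf.smul hg
  have hfg' : HasCompactSupport (fun y => f y • g y) :=
    hasCompactSupport_smul_field f hg'
  have hc : Continuous (fderiv ℝ f) := hf.continuous_fderiv one_ne_zero
  have h₁ : Integrable (fun x => f x * divergence g x) :=
    (hf.continuous.mul (continuous_divergence hg)).integrable_of_hasCompactSupport
      (hasCompactSupport_divergence hg').mul_left
  have h₂ : Integrable (fun x => fderiv ℝ f x (g x)) := by
    refine (hc.clm_apply hg.continuous).integrable_of_hasCompactSupport (hg'.mono fun x hx => ?_)
    contrapose! hx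
    simp_all
  rw [eq_neg_iff_add_eq_zero, ← integral_add h₁ h₂]
  simp_rw [← divergence_smul hf hg]
  exact integral_divergence_eq_zero hfg hfg'

/-- A chain rule tested against a vector field: if `φ' = ψ`, then
`∫ w div (ψ(w) g) = ∫ φ(w) div g`. -/
lemma integral_mul_divergence_smul_comp {w : EuclideanSpace ℝ (Fin n) → ℝ} {φ ψ : ℝ → ℝ}
    (hw : ContDiff ℝ 1 w) (hψ : ContDiff ℝ 1 ψ) (hφ : ∀ t, HasDerivAt φ (ψ t) t)
    (hg : ContDiff ℝ 1 g) (hg' : HasCompactSupport g) :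
    ∫ x, w x * divergence (fun y => ψ (w y) • g y) x = ∫ x, φ (w x) * divergence g x := by
  have hφ' : ContDiff ℝ 1 φ := by
    rw [contDiff_one_iff_deriv, show deriv φ = ψ from funext fun t => (hφ t).deriv]
    exact ⟨fun t => (hφ t).differentiableAt, hψ.continuous⟩
  have hd (x : EuclideanSpace ℝ (Fin n)) :
      fderiv ℝ (fun y => φ (w y)) x = ψ (w x) • fderiv ℝ w x :=
    ((hφ (w x)).comp_hasFDerivAt x (hw.differentiable one_ne_zero x).hasFDerivAt).fderiv
  have hψw : ContDiff ℝ 1 (fun y => ψ (w y)) := hψ.comp hw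
  have hφw : ContDiff ℝ 1 (fun y => φ (w y)) := hφ'.comp hw
  have hψg : ContDiff ℝ 1 (fun y => ψ (w y) • g y) := hψw.smul hg
  rw [integral_mul_divergence hw hψg (hasCompactSupport_smul_field _ hg'), integral_mul_divergence hφw hg hg']
  simp [hd]

end Divergence

section Mollification

variable {n : ℕ} {E F : Set (EuclideanSpace ℝ (Fin n))}
  {g g₁ g₂ : EuclideanSpace ℝ (Fin n) → EuclideanSpace ℝ (Fin n)}

lemma IsAdmissibleField.integral_divergence_le (hg : IsAdmissibleField g) (hE : perimeter E ≠ ⊤) :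
    ∫ x in E, divergence g x ≤ (perimeter E).toReal := by
  rw [← ENNReal.ofReal_le_iff_le_toReal hE]
  exact le_iSup₂_of_le (f := fun g _ => ENNReal.ofReal (∫ x in E, divergence g x)) g hg le_rfl

lemma IsAdmissibleField.comp_add_right (hg : IsAdmissibleField g)
    (t : EuclideanSpace ℝ (Fin n)) : IsAdmissibleField (fun x => g (x + t)) :=
  ⟨hg.1.comp (contDiff_id.add contDiff_const),
    hg.2.1.comp_homeomorph (Homeomorph.addRight t), fun x => hg.2.2 (x + t)⟩

lemma isAdmissibleField_zero :
    IsAdmissibleField (fun _ : EuclideanSpace ℝ (Fin n) => (0 : EuclideanSpace ℝ (Fin n))) :=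
  ⟨contDiff_const, HasCompactSupport.zero, by simp⟩

/-- Mollification of the indicator function of a set. -/
def mollifiedIndicator (ρ : ContDiffBump (0 : EuclideanSpace ℝ (Fin n)))
    (E : Set (EuclideanSpace ℝ (Fin n))) : EuclideanSpace ℝ (Fin n) → ℝ :=
  convolution (ρ.normed volume) (E.indicator fun _ => (1 : ℝ)) (ContinuousLinearMap.lsmul ℝ ℝ)
    volume

lemma mollifiedIndicator_apply (ρ : ContDiffBump (0 : EuclideanSpace ℝ (Fin n)))
    (E : Set (EuclideanSpace ℝ (Fin n))) (x : EuclideanSpace ℝ (Fin n)) :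
    mollifiedIndicator ρ E x =
      ∫ t, ρ.normed volume t * E.indicator (fun _ => (1 : ℝ)) (x - t) := by
  simp [mollifiedIndicator, convolution]

lemma locallyIntegrable_indicator_one (hE : MeasurableSet E) :
    LocallyIntegrable (E.indicator fun _ => (1 : ℝ)) (volume : Measure (EuclideanSpace ℝ (Fin n))) :=
  (locallyIntegrable_const 1).indicator hE

lemma contDiff_mollifiedIndicator (ρ : ContDiffBump (0 : EuclideanSpace ℝ (Fin n)))
    (hE : MeasurableSet E) : ContDiff ℝ 1 (mollifiedIndicator ρ E) :=
  ρ.hasCompactSupport_normed.contDiff_convolution_left (n := 1) _ ρ.contDiff_normed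
    (locallyIntegrable_indicator_one hE)

lemma mollifiedIndicator_mem_Icc (ρ : ContDiffBump (0 : EuclideanSpace ℝ (Fin n)))
    (E : Set (EuclideanSpace ℝ (Fin n))) (x : EuclideanSpace ℝ (Fin n)) :
    mollifiedIndicator ρ E x ∈ Icc (0 : ℝ) 1 := by
  have hle (t : EuclideanSpace ℝ (Fin n)) :
      ρ.normed volume t * E.indicator (fun _ => (1 : ℝ)) (x - t) ≤ ρ.normed volume t :=
    mul_le_of_le_one_right (ρ.nonneg_normed t) (indicator_le_self' (by simp) _)
  have hnonneg (t : EuclideanSpace ℝ (Fin n)) :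
      0 ≤ ρ.normed volume t * E.indicator (fun _ => (1 : ℝ)) (x - t) :=
    mul_nonneg (ρ.nonneg_normed t) (indicator_nonneg (by simp) _)
  rw [mollifiedIndicator_apply]
  refine ⟨integral_nonneg hnonneg, ?_⟩
  exact (integral_mono_of_nonneg (.of_forall hnonneg) ρ.integrable_normed (.of_forall hle)).trans
    ρ.integral_normed.le

/-- Mollifying the indicator function of a set does not increase its total variation. -/
lemma integral_mollifiedIndicator_mul_divergence_le
    (ρ : ContDiffBump (0 : EuclideanSpace ℝ (Fin n))) (hE : MeasurableSet E)
    (hP : perimeter E ≠ ⊤) (hg : IsAdmissibleField g) :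
    ∫ x, mollifiedIndicator ρ E x * divergence g x ≤ (perimeter E).toReal := by
  have hint : Integrable (fun p : EuclideanSpace ℝ (Fin n) × EuclideanSpace ℝ (Fin n) =>
      E.indicator (fun _ => (1 : ℝ)) (p.1 - p.2) * (divergence g p.1 * ρ.normed volume p.2))
      (volume.prod volume) := by
    refine ((integrable_divergence hg.1 hg.2.1).mul_prod ρ.integrable_normed).bdd_mul (c := 1) ?_ ?_
    · exact ((measurable_const.indicator hE).comp
        (measurable_fst.sub measurable_snd)).aestronglyMeasurable
    · refine .of_forall fun p => ?_
      rw [norm_indicator_eq_indicator_norm]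
      exact indicator_le_self' (by simp) _ |>.trans (by simp)
  have hinner (t : EuclideanSpace ℝ (Fin n)) :
      ∫ x, E.indicator (fun _ => (1 : ℝ)) (x - t) * (divergence g x * ρ.normed volume t)
        = (∫ x in E, divergence (fun y => g (y + t)) x) * ρ.normed volume t := by
    rw [← integral_add_right_eq_self _ t, ← integral_indicator hE, ← integral_mul_const]
    refine integral_congr_ae (.of_forall fun x => ?_)
    by_cases hx : x ∈ E <;> simp [hx, divergence_comp_add_right]
  have hswap : ∫ x, mollifiedIndicator ρ E x * divergence g x
      = ∫ t, (∫ x in E, divergence (fun y => g (y + t)) x) * ρ.normed volume t := by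
    simp_rw [← hinner]
    rw [← integral_integral_swap hint]
    refine integral_congr_ae (.of_forall fun x => ?_)
    simp only [mollifiedIndicator_apply]
    rw [← integral_mul_const]
    refine integral_congr_ae (.of_forall fun t => ?_)
    simp only
    ring
  have hint' : Integrable
      (fun t => (∫ x in E, divergence (fun y => g (y + t)) x) * ρ.normed volume t) := by
    simpa only [hinner] using hint.integral_prod_right
  calc ∫ x, mollifiedIndicator ρ E x * divergence g x
      = ∫ t, (∫ x in E, divergence (fun y => g (y + t)) x) * ρ.normed volume t := hswap
    _ ≤ ∫ t, (perimeter E).toReal * ρ.normed volume t := by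
        refine integral_mono hint' (ρ.integrable_normed.const_mul _) fun t => ?_
        exact mul_le_mul_of_nonneg_right ((hg.comp_add_right t).integral_divergence_le hP)
          (ρ.nonneg_normed t)
    _ = (perimeter E).toReal := by rw [integral_const_mul, ρ.integral_normed, mul_one]

lemma exists_bump_sequence : ∃ ρ : ℕ → ContDiffBump (0 : EuclideanSpace ℝ (Fin n)),
    ∀ E : Set (EuclideanSpace ℝ (Fin n)), MeasurableSet E → ∀ᵐ x,
      Tendsto (fun k => mollifiedIndicator (ρ k) E x) atTop
        (𝓝 (E.indicator (fun _ => (1 : ℝ)) x)) := by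
  have hpos (k : ℕ) : (0 : ℝ) < 1 / (k + 1) := Nat.one_div_pos_of_nat
  refine ⟨fun k => ⟨1 / (k + 1), 2 * (1 / (k + 1)), hpos k, by linarith [hpos k]⟩, fun E hE => ?_⟩
  refine ContDiffBump.ae_convolution_tendsto_right_of_locallyIntegrable (K := 2) ?_
    (.of_forall fun k => le_rfl) (locallyIntegrable_indicator_one hE)
  simpa using (tendsto_one_div_add_atTop_nhds_zero_nat (𝕜 := ℝ)).const_mul 2

end Mollification

section Submodularity

variable {n : ℕ} {E F : Set (EuclideanSpace ℝ (Fin n))}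
  {g₁ g₂ : EuclideanSpace ℝ (Fin n) → EuclideanSpace ℝ (Fin n)}

/-- The convex combination `(1 + χ)/2 • g₁ + (1 - χ)/2 • g₂` of two vector fields. -/
def mixField (χ : EuclideanSpace ℝ (Fin n) → ℝ)
    (g₁ g₂ : EuclideanSpace ℝ (Fin n) → EuclideanSpace ℝ (Fin n))
    (x : EuclideanSpace ℝ (Fin n)) : EuclideanSpace ℝ (Fin n) :=
  (2⁻¹ : ℝ) • ((g₁ x + g₂ x) + χ x • (g₁ x - g₂ x))

lemma IsAdmissibleField.mixField {χ : EuclideanSpace ℝ (Fin n) → ℝ} (hχ : ContDiff ℝ 1 χ)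
    (hχ' : ∀ x, |χ x| ≤ 1) (h₁ : IsAdmissibleField g₁) (h₂ : IsAdmissibleField g₂) :
    IsAdmissibleField (mixField χ g₁ g₂) := by
  refine ⟨?_, ?_, fun x => ?_⟩
  · exact ((h₁.1.add h₂.1).add (hχ.smul (h₁.1.sub h₂.1))).const_smul (2⁻¹ : ℝ)
  · refine (h₁.2.1.union h₂.2.1).of_isClosed_subset (isClosed_tsupport _) ?_
    refine closure_minimal (fun x hx => ?_)
      ((isClosed_tsupport g₁).union (isClosed_tsupport g₂))
    by_contra hx'
    rw [mem_union, not_or] at hx'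
    exact hx (by simp [_root_.mixField, image_eq_zero_of_notMem_tsupport hx'.1,
      image_eq_zero_of_notMem_tsupport hx'.2])
  · obtain ⟨hl, hr⟩ := abs_le.1 (hχ' x)
    have h : _root_.mixField χ g₁ g₂ x = ((1 + χ x) / 2) • g₁ x + ((1 - χ x) / 2) • g₂ x := by
      simp only [_root_.mixField]
      module
    rw [h, ← mem_closedBall_zero_iff]
    exact convex_closedBall (0 : EuclideanSpace ℝ (Fin n)) 1
      (mem_closedBall_zero_iff.2 (h₁.2.2 x)) (mem_closedBall_zero_iff.2 (h₂.2.2 x))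
      (by linarith) (by linarith) (by ring)

lemma divergence_mixField {χ : EuclideanSpace ℝ (Fin n) → ℝ} (hχ : ContDiff ℝ 1 χ)
    (h₁ : ContDiff ℝ 1 g₁) (h₂ : ContDiff ℝ 1 g₂) (x : EuclideanSpace ℝ (Fin n)) :
    divergence (mixField χ g₁ g₂) x = 2⁻¹ * (divergence g₁ x + divergence g₂ x +
      (χ x * (divergence g₁ x - divergence g₂ x) + fderiv ℝ χ x (g₁ x - g₂ x))) := by
  have hadd : ContDiff ℝ 1 (fun y => g₁ y + g₂ y) := h₁.add h₂
  have hsub : ContDiff ℝ 1 (fun y => g₁ y - g₂ y) := h₁.sub h₂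
  have hsmul : ContDiff ℝ 1 (fun y => χ y • (g₁ y - g₂ y)) := hχ.smul hsub
  have hsum : ContDiff ℝ 1 (fun y => g₁ y + g₂ y + χ y • (g₁ y - g₂ y)) := hadd.add hsmul
  have h := divergence_const_smul 2⁻¹ hsum x
  rw [divergence_add hadd hsmul, divergence_add h₁ h₂, divergence_smul hχ hsub,
    divergence_sub h₁ h₂] at h
  exact h

lemma hasDerivAt_sqrt_sq_add_sq {δ : ℝ} (hδ : 0 < δ) (t : ℝ) :
    HasDerivAt (fun t => √(t ^ 2 + δ ^ 2)) (t / √(t ^ 2 + δ ^ 2)) t := by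
  have h : HasDerivAt (fun t : ℝ => t ^ 2 + δ ^ 2) (2 * t) t := by
    simpa using (hasDerivAt_pow 2 t).add_const (δ ^ 2)
  convert! h.sqrt (by positivity) using 1
  field_simp

lemma contDiff_div_sqrt_sq_add_sq {δ : ℝ} (hδ : 0 < δ) :
    ContDiff ℝ 1 (fun t : ℝ => t / √(t ^ 2 + δ ^ 2)) := by
  have hpos (t : ℝ) : 0 < t ^ 2 + δ ^ 2 := by positivity
  have h : ContDiff ℝ 1 (fun t : ℝ => t ^ 2 + δ ^ 2) := by fun_prop
  exact contDiff_id.div (h.sqrt fun t => (hpos t).ne') fun t => (Real.sqrt_pos.2 (hpos t)).ne'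

lemma abs_div_sqrt_sq_add_sq_le_one (δ t : ℝ) : |t / √(t ^ 2 + δ ^ 2)| ≤ 1 := by
  rw [abs_div, abs_of_nonneg (Real.sqrt_nonneg _)]
  exact div_le_one_of_le₀ (Real.abs_le_sqrt (by nlinarith [sq_nonneg δ])) (Real.sqrt_nonneg _)

/-- Submodularity of the perimeter for mollified indicators, with the maximum and the minimum
regularized through `√(t² + δ²)` in place of `|t|`. -/
lemma integral_regularized_max_min_le (ρ : ContDiffBump (0 : EuclideanSpace ℝ (Fin n)))
    (hE : MeasurableSet E) (hF : MeasurableSet F)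
    (hPE : perimeter E ≠ ⊤) (hPF : perimeter F ≠ ⊤)
    (h₁ : IsAdmissibleField g₁) (h₂ : IsAdmissibleField g₂) {δ : ℝ} (hδ : 0 < δ) :
    ∫ x, ((mollifiedIndicator ρ E x + mollifiedIndicator ρ F x) *
        (divergence g₁ x + divergence g₂ x) +
      √((mollifiedIndicator ρ E x - mollifiedIndicator ρ F x) ^ 2 + δ ^ 2) *
        (divergence g₁ x - divergence g₂ x)) / 2
      ≤ (perimeter E).toReal + (perimeter F).toReal := by
  set u := mollifiedIndicator ρ E
  set v := mollifiedIndicator ρ F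
  have hu : ContDiff ℝ 1 u := contDiff_mollifiedIndicator ρ hE
  have hv : ContDiff ℝ 1 v := contDiff_mollifiedIndicator ρ hF
  have hw : ContDiff ℝ 1 (fun x => u x - v x) := hu.sub hv
  set χ : EuclideanSpace ℝ (Fin n) → ℝ :=
    fun x => (u x - v x) / √((u x - v x) ^ 2 + δ ^ 2)
  have hχ : ContDiff ℝ 1 χ := (contDiff_div_sqrt_sq_add_sq hδ).comp hw
  have hχn : ContDiff ℝ 1 (fun x => -χ x) := hχ.neg
  have hχ' (x) : |χ x| ≤ 1 := abs_div_sqrt_sq_add_sq_le_one δ _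
  have hG₁ := IsAdmissibleField.mixField hχ hχ' h₁ h₂
  have hG₂ := IsAdmissibleField.mixField hχn (fun x => by simpa using hχ' x) h₁ h₂
  have hsub : ContDiff ℝ 1 (fun y => g₁ y - g₂ y) := h₁.1.sub h₂.1
  have hsub' : HasCompactSupport (fun y => g₁ y - g₂ y) := h₁.2.1.sub h₂.2.1
  have hχsub : ContDiff ℝ 1 (fun y => χ y • (g₁ y - g₂ y)) := hχ.smul hsub
  have hχsub' := hasCompactSupport_smul_field χ hsub'
  have hint {f : EuclideanSpace ℝ (Fin n) → ℝ} {g} (hf : Continuous f) (hg : ContDiff ℝ 1 g)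
      (hg' : HasCompactSupport g) : Integrable (fun x => f x * divergence g x) :=
    (hf.mul (continuous_divergence hg)).integrable_of_hasCompactSupport
      (hasCompactSupport_divergence hg').mul_left
  have hs : Continuous (fun x => (u x + v x) / 2) := (hu.continuous.add hv.continuous).div_const 2
  have hsqrt : Continuous (fun x => √((u x - v x) ^ 2 + δ ^ 2)) :=
    ((hw.continuous.pow 2).add continuous_const).sqrt
  have hmain : Integrable (fun x => (u x + v x) / 2 * divergence g₁ x +
      (u x + v x) / 2 * divergence g₂ x) := (hint hs h₁.1 h₁.2.1).add (hint hs h₂.1 h₂.2.1)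
  have hchain : ∫ x, (u x - v x) * divergence (fun y => χ y • (g₁ y - g₂ y)) x
      = ∫ x, √((u x - v x) ^ 2 + δ ^ 2) * divergence (fun y => g₁ y - g₂ y) x :=
    integral_mul_divergence_smul_comp hw (contDiff_div_sqrt_sq_add_sq hδ)
      (hasDerivAt_sqrt_sq_add_sq hδ) hsub hsub'
  have hneg (x) : fderiv ℝ (fun y => -χ y) x = -fderiv ℝ χ x := fderiv_fun_neg
  refine le_of_eq_of_le ?_ (add_le_add
    (integral_mollifiedIndicator_mul_divergence_le ρ hE hPE hG₁)
    (integral_mollifiedIndicator_mul_divergence_le ρ hF hPF hG₂))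
  calc _ = ∫ x, (((u x + v x) / 2 * divergence g₁ x + (u x + v x) / 2 * divergence g₂ x) +
          2⁻¹ * (√((u x - v x) ^ 2 + δ ^ 2) * divergence (fun y => g₁ y - g₂ y) x)) := by
        refine integral_congr_ae (.of_forall fun x => ?_)
        simp only [divergence_sub h₁.1 h₂.1]
        ring
    _ = ∫ x, (((u x + v x) / 2 * divergence g₁ x + (u x + v x) / 2 * divergence g₂ x) +
          2⁻¹ * ((u x - v x) * divergence (fun y => χ y • (g₁ y - g₂ y)) x)) := by
        rw [integral_add hmain ((hint hsqrt hsub hsub').const_mul _),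
          integral_add hmain ((hint hw.continuous hχsub hχsub').const_mul _),
          integral_const_mul, integral_const_mul, hchain]
    _ = _ := by
        rw [← integral_add (hint hu.continuous hG₁.1 hG₁.2.1) (hint hv.continuous hG₂.1 hG₂.2.1)]
        refine integral_congr_ae (.of_forall fun x => ?_)
        simp only [divergence_mixField hχ h₁.1 h₂.1, divergence_mixField hχn h₁.1 h₂.1,
          divergence_smul hχ hsub, divergence_sub h₁.1 h₂.1, hneg, neg_apply]
        ring

lemma integral_union_add_integral_inter_le (hE : MeasurableSet E) (hF : MeasurableSet F)
    (hPE : perimeter E ≠ ⊤) (hPF : perimeter F ≠ ⊤)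
    (h₁ : IsAdmissibleField g₁) (h₂ : IsAdmissibleField g₂) :
    (∫ x in E ∪ F, divergence g₁ x) + ∫ x in E ∩ F, divergence g₂ x
      ≤ (perimeter E).toReal + (perimeter F).toReal := by
  obtain ⟨ρ, hρ⟩ := exists_bump_sequence (n := n)
  set a := divergence g₁
  set b := divergence g₂
  have ha : Integrable a := integrable_divergence h₁.1 h₁.2.1
  have hb : Integrable b := integrable_divergence h₂.1 h₂.2.1
  set u : ℕ → EuclideanSpace ℝ (Fin n) → ℝ := fun k => mollifiedIndicator (ρ k) E
  set v : ℕ → EuclideanSpace ℝ (Fin n) → ℝ := fun k => mollifiedIndicator (ρ k) F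
  have hlim : Tendsto (fun k : ℕ => ∫ x, ((u k x + v k x) * (a x + b x) +
      √((u k x - v k x) ^ 2 + (1 / ((k : ℝ) + 1)) ^ 2) * (a x - b x)) / 2) atTop
      (𝓝 (∫ x, ((E ∪ F).indicator a x + (E ∩ F).indicator b x))) := by
    refine tendsto_integral_of_dominated_convergence (fun x => 2 * (|a x| + |b x|)) (fun k => ?_)
      ((ha.abs.add hb.abs).const_mul 2) (fun k => .of_forall fun x => ?_) ?_
    · have hu : Continuous (u k) := (contDiff_mollifiedIndicator (ρ k) hE).continuous
      have hv : Continuous (v k) := (contDiff_mollifiedIndicator (ρ k) hF).continuous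
      have ha' : Continuous a := continuous_divergence h₁.1
      have hb' : Continuous b := continuous_divergence h₂.1
      exact Continuous.aestronglyMeasurable (by fun_prop)
    · obtain ⟨hu₀, hu₁⟩ := mollifiedIndicator_mem_Icc (ρ k) E x
      obtain ⟨hv₀, hv₁⟩ := mollifiedIndicator_mem_Icc (ρ k) F x
      change 0 ≤ u k x at hu₀
      change u k x ≤ 1 at hu₁
      change 0 ≤ v k x at hv₀
      change v k x ≤ 1 at hv₁
      have hδ₀ : 0 ≤ 1 / ((k : ℝ) + 1) := by positivity
      have hδ₁ : 1 / ((k : ℝ) + 1) ≤ 1 :=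
        div_le_one_of_le₀ (by simp) (by positivity)
      have hs : √((u k x - v k x) ^ 2 + (1 / ((k : ℝ) + 1)) ^ 2) ≤ 2 :=
        Real.sqrt_le_iff.2 ⟨by norm_num, by nlinarith⟩
      have h₁ : |(u k x + v k x) * (a x + b x)| ≤ 2 * (|a x| + |b x|) := by
        rw [abs_mul, abs_of_nonneg (by linarith : 0 ≤ u k x + v k x)]
        exact mul_le_mul (by linarith) (abs_add_le _ _) (abs_nonneg _) zero_le_two
      have h₂ : |√((u k x - v k x) ^ 2 + (1 / ((k : ℝ) + 1)) ^ 2) * (a x - b x)|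
          ≤ 2 * (|a x| + |b x|) := by
        rw [abs_mul, abs_of_nonneg (Real.sqrt_nonneg _)]
        exact mul_le_mul hs (abs_sub _ _) (abs_nonneg _) zero_le_two
      rw [Real.norm_eq_abs, abs_div, abs_two, div_le_iff₀ zero_lt_two]
      exact (abs_add_le _ _).trans (by linarith)
    · filter_upwards [hρ E hE, hρ F hF] with x hxE hxF
      have hδ : Tendsto (fun k : ℕ => 1 / ((k : ℝ) + 1)) atTop (𝓝 0) :=
        tendsto_one_div_add_atTop_nhds_zero_nat
      have h := ((((hxE.add hxF).mul_const (a x + b x)).add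
        ((((hxE.sub hxF).pow 2).add (hδ.pow 2)).sqrt.mul_const (a x - b x))).div_const 2)
      convert! h using 2
      by_cases hxE : x ∈ E <;> by_cases hxF : x ∈ F <;> (simp [hxE, hxF]; try ring)
  have hlimit : ∫ x, ((E ∪ F).indicator a x + (E ∩ F).indicator b x)
      = (∫ x in E ∪ F, a x) + ∫ x in E ∩ F, b x := by
    rw [integral_add (ha.indicator (hE.union hF)) (hb.indicator (hE.inter hF)),
      integral_indicator (hE.union hF), integral_indicator (hE.inter hF)]
  rw [← hlimit]
  exact le_of_tendsto' hlim fun k =>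
    integral_regularized_max_min_le (ρ k) hE hF hPE hPF h₁ h₂ Nat.one_div_pos_of_nat

/-- The perimeter is submodular. -/
theorem perimeter_union_add_perimeter_inter_le (hE : MeasurableSet E) (hF : MeasurableSet F) :
    perimeter (E ∪ F) + perimeter (E ∩ F) ≤ perimeter E + perimeter F := by
  by_cases hPE : perimeter E = ⊤
  · simp [hPE]
  by_cases hPF : perimeter F = ⊤
  · simp [hPF]
  have hpos (A : Set (EuclideanSpace ℝ (Fin n))) {g} (hg : IsAdmissibleField g) :
      ∃ g', IsAdmissibleField g' ∧ 0 ≤ ∫ x in A, divergence g' x ∧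
        ENNReal.ofReal (∫ x in A, divergence g x) =
          ENNReal.ofReal (∫ x in A, divergence g' x) := by
    rcases le_total 0 (∫ x in A, divergence g x) with h | h
    · exact ⟨g, hg, h, rfl⟩
    · refine ⟨_, isAdmissibleField_zero, ?_⟩
      rw [ENNReal.ofReal_of_nonpos h]
      simp [divergence]
  refine ENNReal.biSup_add_biSup_le' (p := IsAdmissibleField) (q := IsAdmissibleField)
    ⟨_, isAdmissibleField_zero⟩ ⟨_, isAdmissibleField_zero⟩ fun g₁ h₁ g₂ h₂ => ?_
  obtain ⟨g₁', h₁', hn₁, e₁⟩ := hpos (E ∪ F) h₁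
  obtain ⟨g₂', h₂', hn₂, e₂⟩ := hpos (E ∩ F) h₂
  rw [e₁, e₂, ← ENNReal.ofReal_add hn₁ hn₂, ← ENNReal.ofReal_toReal hPE,
    ← ENNReal.ofReal_toReal hPF, ← ENNReal.ofReal_add ENNReal.toReal_nonneg ENNReal.toReal_nonneg]
  exact ENNReal.ofReal_le_ofReal (integral_union_add_integral_inter_le hE hF hPE hPF h₁' h₂')

end Submodularity

lemma cheegerConstant_mul_volume_le {n : ℕ} {Ω A : Set (EuclideanSpace ℝ (Fin n))}
    (hA : MeasurableSet A) (hAΩ : A ⊆ Ω) (hAfin : volume A ≠ ⊤) :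
    cheegerConstant Ω * volume A ≤ perimeter A := by
  rcases eq_or_ne (volume A) 0 with h0 | h0
  · simp [h0]
  · rw [← ENNReal.le_div_iff_mul_le (.inl h0) (.inl hAfin)]
    exact iInf₂_le A ⟨hA, hAΩ, pos_iff_ne_zero.2 h0⟩

lemma isCheegerSet_of_perimeter_le {n : ℕ} {Ω A : Set (EuclideanSpace ℝ (Fin n))}
    (hA : MeasurableSet A) (hAΩ : A ⊆ Ω) (hApos : 0 < volume A)
    (h : perimeter A ≤ cheegerConstant Ω * volume A) : IsCheegerSet Ω A :=
  ⟨hA, hAΩ, hApos, le_antisymm (ENNReal.div_le_of_le_mul h) (iInf₂_le A ⟨hA, hAΩ, hApos⟩)⟩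

/-- **Union and intersection of Cheeger sets.** If `E` and `F` are both Cheeger sets in a
nonempty bounded open set `Ω ⊆ ℝⁿ` (`n ≥ 2`), then `E ∪ F` is a Cheeger set in `Ω`, and
`E ∩ F` is also a Cheeger set in `Ω` provided `|E ∩ F| > 0`. -/
theorem cheegerSet_union_inter {n : ℕ} (hn : 2 ≤ n)
    (Ω : Set (EuclideanSpace ℝ (Fin n)))
    (hΩne : Ω.Nonempty) (hΩop : IsOpen Ω) (hΩbd : Bornology.IsBounded Ω)
    (E F : Set (EuclideanSpace ℝ (Fin n)))
    (hE : IsCheegerSet Ω E) (hF : IsCheegerSet Ω F) :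
    IsCheegerSet Ω (E ∪ F) ∧ (0 < volume (E ∩ F) → IsCheegerSet Ω (E ∩ F)) := by
  obtain ⟨hEm, hEΩ, hEpos, hEeq⟩ := hE
  obtain ⟨hFm, hFΩ, hFpos, hFeq⟩ := hF
  have hfin {A : Set (EuclideanSpace ℝ (Fin n))} (hA : A ⊆ Ω) : volume A ≠ ⊤ :=
    (hΩbd.subset hA).measure_lt_top.ne
  have hUm := hEm.union hFm
  have hIm := hEm.inter hFm
  have hUΩ : E ∪ F ⊆ Ω := union_subset hEΩ hFΩ
  have hIΩ : E ∩ F ⊆ Ω := inter_subset_left.trans hEΩ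
  have hUpos : 0 < volume (E ∪ F) := hEpos.trans_le (measure_mono subset_union_left)
  by_cases htop : cheegerConstant Ω = ⊤
  · refine ⟨isCheegerSet_of_perimeter_le hUm hUΩ hUpos ?_, fun hIpos =>
      isCheegerSet_of_perimeter_le hIm hIΩ hIpos ?_⟩
    · simp [htop, ENNReal.top_mul hUpos.ne']
    · simp [htop, ENNReal.top_mul hIpos.ne']
  have hEP : cheegerConstant Ω * volume E = perimeter E := by
    rw [← hEeq, ENNReal.div_mul_cancel hEpos.ne' (hfin hEΩ)]
  have hFP : cheegerConstant Ω * volume F = perimeter F := by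
    rw [← hFeq, ENNReal.div_mul_cancel hFpos.ne' (hfin hFΩ)]
  have hsum : perimeter (E ∪ F) + perimeter (E ∩ F) ≤
      cheegerConstant Ω * volume (E ∪ F) + cheegerConstant Ω * volume (E ∩ F) := by
    rw [← mul_add, measure_union_add_inter E hFm, mul_add, hEP, hFP]
    exact perimeter_union_add_perimeter_inter_le hEm hFm
  have hU := cheegerConstant_mul_volume_le hUm hUΩ (hfin hUΩ)
  have hI := cheegerConstant_mul_volume_le hIm hIΩ (hfin hIΩ)
  refine ⟨isCheegerSet_of_perimeter_le hUm hUΩ hUpos ?_, fun hIpos =>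
    isCheegerSet_of_perimeter_le hIm hIΩ hIpos ?_⟩
  · exact (ENNReal.add_le_add_iff_right (ENNReal.mul_ne_top htop (hfin hIΩ))).1
      ((add_le_add_right hI _).trans hsum)
  · exact (ENNReal.add_le_add_iff_left (ENNReal.mul_ne_top htop (hfin hUΩ))).1
      ((add_le_add_left hU _).trans hsum)
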